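/- Let Ω ⊂ ℂ² be a bounded convex Reinhardt domain and, for w ∈ ℂ, set Δ_w = {z ∈ ℂ : (z, w) ∈ cl(Ω)}. Suppose that for some w₀ ∈ ℂ the set Δ_{w₀} is nonempty and Δ_{w₀} × {w₀} ⊂ ∂Ω. Then for every w ∈ ℂ with Δ_w nonempty one has |w| ≤ |w₀| and Δ_{w₀} ⊆ Δ_w; in particular, the radius of the closed disk Δ_w is at least the radius r₀ of Δ_{w₀}. -/

import Mathlib

open MeasureTheory Metric Complex Filter Set Topology

def IsReinhardt (Ω : Set (ℂ × ℂ)) : Prop :=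
  ∀ p ∈ Ω, ∀ θ₁ θ₂ : ℝ, (Complex.exp (θ₁ * Complex.I) * (Prod.fst p),
    Complex.exp (θ₂ * Complex.I) * (Prod.snd p)) ∈ Ω

theorem exists_rot (a b : ℂ) (h : ‖a‖ = ‖b‖) : ∃ θ : ℝ, Complex.exp (θ * Complex.I) * a = b := by
  refine ⟨Complex.arg b - Complex.arg a, ?_⟩
  have ha := Complex.norm_mul_exp_arg_mul_I a
  have hb := Complex.norm_mul_exp_arg_mul_I b
  calc _ = Complex.exp (((Complex.arg b - Complex.arg a : ℝ) : ℂ) * Complex.I) *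
        (‖a‖ * Complex.exp (Complex.arg a * Complex.I)) := by rw [ha]
    _ = ‖a‖ * (Complex.exp (((Complex.arg b - Complex.arg a : ℝ) : ℂ) * Complex.I) *
        Complex.exp (Complex.arg a * Complex.I)) := by ring
    _ = ‖b‖ * Complex.exp (Complex.arg b * Complex.I) := by
        rw [← Complex.exp_add, h]; push_cast; ring_nf
    _ = b := hb

theorem IsReinhardt.closure_rein {Ω : Set (ℂ × ℂ)} (h : IsReinhardt Ω) :
    IsReinhardt (closure Ω) := by
  intro p hp θ₁ θ₂
  have hc : Continuous (fun p : ℂ × ℂ => (Complex.exp (θ₁ * Complex.I) * (Prod.fst p),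
    Complex.exp (θ₂ * Complex.I) * (Prod.snd p))) := by fun_prop
  have := map_mem_closure hc hp (t := Ω) (fun q hq => h q hq θ₁ θ₂)
  exact this

theorem IsReinhardt.mem_norm {Ω : Set (ℂ × ℂ)} (h : IsReinhardt Ω) {z w z' w' : ℂ}
    (hp : (z, w) ∈ Ω) (hz : ‖z‖ = ‖z'‖) (hw : ‖w‖ = ‖w'‖) : (z', w') ∈ Ω := by
  obtain ⟨a, ha⟩ := exists_rot z z' hz
  obtain ⟨b, hb⟩ := exists_rot w w' hw
  have := h _ hp a b
  simpa only [ha, hb] using this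

/-- Convex Reinhardt sets are complete: moduli can be decreased. -/
theorem IsReinhardt.mem_le {Ω : Set (ℂ × ℂ)} (h : IsReinhardt Ω) (hc : Convex ℝ Ω) {z w w' : ℂ}
    (hp : (z, w) ∈ Ω) (hw : ‖w'‖ ≤ ‖w‖) : (z, w') ∈ Ω := by
  rcases eq_or_ne w 0 with rfl | h0
  · have : w' = 0 := by simpa using hw
    rwa [this]
  have hpos : 0 < ‖w‖ := norm_pos_iff.mpr h0
  set s : ℝ := ‖w'‖ / ‖w‖ with hs
  have hs0 : 0 ≤ s := by positivity
  have hs1 : s ≤ 1 := (div_le_one hpos).mpr hw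
  have hm : (z, -w) ∈ Ω := h.mem_norm hp rfl (by simp)
  have hq := hc hp hm (a := (1 + s) / 2) (b := (1 - s) / 2) (by linarith) (by linarith) (by ring)
  have he : ((1 + s) / 2) • (z, w) + ((1 - s) / 2) • (z, -w) = (z, (s : ℂ) * w) := by
    ext1 <;> simp <;> ring
  rw [he] at hq
  refine h.mem_norm hq rfl ?_
  rw [norm_mul, Complex.norm_real, Real.norm_of_nonneg hs0, hs]
  field_simp

/-- If `Δ_{w₀} × {w₀}` lies in the boundary of a bounded convex Reinhardt domain
in `ℂ²`, then `|w| ≤ |w₀|` and `Δ_{w₀} ⊆ Δ_w` for every `w` with `Δ_w ≠ ∅`; in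
particular the radius of `Δ_w` is at least that of `Δ_{w₀}`. -/
theorem boundary_slice_is_smallest
    (Ω : Set (ℂ × ℂ)) (hΩopen : IsOpen Ω) (hΩne : Ω.Nonempty)
    (hΩconv : Convex ℝ Ω) (hΩbdd : Bornology.IsBounded Ω)
    (hΩRein : IsReinhardt Ω)
    (Δ : ℂ → Set ℂ) (hΔ : ∀ w, Δ w = {z : ℂ | (z, w) ∈ closure Ω})
    (w₀ : ℂ) (hw₀ne : (Δ w₀).Nonempty)
    (hw₀bd : (Δ w₀) ×ˢ {w₀} ⊆ frontier Ω) :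
    ∀ w : ℂ, (Δ w).Nonempty →
      ‖w‖ ≤ ‖w₀‖ ∧ Δ w₀ ⊆ Δ w ∧
        sSup ((fun z : ℂ => ‖z‖) '' Δ w₀) ≤
          sSup ((fun z : ℂ => ‖z‖) '' Δ w) := by
  have hR := hΩRein.closure_rein
  have hC : Convex ℝ (closure Ω) := hΩconv.closure
  have zero_mem : ∀ {S : Set (ℂ × ℂ)}, IsReinhardt S → Convex ℝ S → ∀ z w : ℂ,
      (z, w) ∈ S → ((0 : ℂ), w) ∈ S := by
    intro S hS hSc z w hzw
    have hm : (-z, w) ∈ S := hS.mem_norm hzw (by simp) rfl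
    have hq := hSc hzw hm (a := 1 / 2) (b := 1 / 2) (by norm_num) (by norm_num) (by norm_num)
    have he : (1 / 2 : ℝ) • (z, w) + (1 / 2 : ℝ) • (-z, w) = ((0 : ℂ), w) := by
      ext1 <;> simp
      ring
    rwa [he] at hq
  intro w hw
  have hle : ‖w‖ ≤ ‖w₀‖ := by
    by_contra! hlt
    obtain ⟨z, hz⟩ := hw
    rw [hΔ] at hz
    have hz0 : ((0 : ℂ), w) ∈ closure Ω := zero_mem hR hC z w hz
    obtain ⟨z₀, hz₀⟩ := hw₀ne
    have hz₀' : (z₀, w₀) ∈ closure Ω := by rw [hΔ] at hz₀; exact hz₀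
    have h0 : ((0 : ℂ), w₀) ∈ closure Ω := zero_mem hR hC z₀ w₀ hz₀'
    have hf : ((0 : ℂ), w₀) ∈ frontier Ω := hw₀bd ⟨by rw [hΔ]; exact h0, rfl⟩
    rw [hΩopen.frontier_eq] at hf
    apply hf.2
    obtain ⟨⟨a, b⟩, hab⟩ := hΩne
    have h00 : ((0 : ℂ), (0 : ℂ)) ∈ Ω :=
      hΩRein.mem_le hΩconv (zero_mem hΩRein hΩconv a b hab) (by simp)
    have hpos : 0 < ‖w‖ := lt_of_le_of_lt (norm_nonneg _) hlt
    set t : ℝ := ‖w₀‖ / ‖w‖ with ht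
    have ht0 : 0 ≤ t := by positivity
    have ht1 : t < 1 := (div_lt_one hpos).mpr hlt
    have hq := hΩconv.combo_interior_closure_mem_interior (a := 1 - t) (b := t)
      (by rwa [hΩopen.interior_eq]) hz0 (by linarith) ht0 (by ring)
    rw [hΩopen.interior_eq] at hq
    have he : (1 - t) • ((0 : ℂ), (0 : ℂ)) + t • ((0 : ℂ), w) = (0, (t : ℂ) * w) := by
      ext1 <;> simp
    rw [he] at hq
    refine hΩRein.mem_norm hq rfl ?_
    rw [norm_mul, Complex.norm_real, Real.norm_of_nonneg ht0, ht]
    field_simp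
  have hsub : Δ w₀ ⊆ Δ w := by
    intro z hz
    rw [hΔ] at hz ⊢
    exact hR.mem_le hC hz hle
  refine ⟨hle, hsub, csSup_le_csSup ?_ (hw₀ne.image _) (image_mono hsub)⟩
  obtain ⟨M, hM⟩ := hΩbdd.closure.exists_norm_le
  refine ⟨M, ?_⟩
  rintro _ ⟨z, hz, rfl⟩
  rw [hΔ] at hz
  exact (norm_fst_le (z, w)).trans (hM _ hz)
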